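/- There exists a Euclidean tight 6-design of ℝ^22 supported by two concentric spheres. Concretely: there exist a finite set X1 contained in the sphere of radius 1 centered at the origin of ℝ^22 with |X1| = 275, and a finite set X2 contained in the sphere of radius √11 centered at the origin with |X2| = 2025 (so |X1 ∪ X2| = C(25,3) = 2300), such that with the weight function w ≡ 729 on X1 and w ≡ 1 on X2, the pair (X1 ∪ X2, w) is a Euclidean 6-design of ℝ^22. -/

import Mathlib

open MeasureTheory Metric MvPolynomial
open scoped RealInnerProductSpace Classical

/-- Average of a polynomial over the sphere of radius `r` centered at the origin in `ℝⁿ`,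
with respect to the (rotation-invariant, normalized) surface measure. -/
noncomputable def sphereAvg (n : ℕ) (r : ℝ) (f : MvPolynomial (Fin n) ℝ) : ℝ :=
  ⨍ u : sphere (0 : EuclideanSpace ℝ (Fin n)) 1,
    eval (fun i => r * (u : EuclideanSpace ℝ (Fin n)) i) f
    ∂((volume : Measure (EuclideanSpace ℝ (Fin n))).toSphere)

open Finset

/-- Columns of a systematic generator matrix of the `[22, 10, 8]` shortened Golay code, as binary
numbers; the binary digit of index `10` is the coset representative of the words used for signs. -/
def golayColumns : List ℕ :=
  [1, 2, 4, 8, 16, 32, 64, 128, 256, 512, 1594, 1615, 1701, 1905, 1241, 435, 870, 1270, 493, 986,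
    1422, 797]

/-- The rows of the generator matrix with columns `golayColumns`. -/
def golayRows : List ℕ :=
  [2422785, 1805314, 3610628, 3951624, 2810896, 504864, 1009728, 2019456, 4038912, 2702848]

/-- The blocks of a Steiner system `S(3, 6, 22)`. -/
def hexadList : List (List ℕ) :=
  [[0, 1, 2, 4, 13, 16], [0, 1, 3, 12, 15, 21], [0, 1, 5, 6, 18, 20], [0, 1, 7, 10, 11, 17], [0,
    1, 8, 9, 14, 19], [0, 2, 3, 10, 18, 19], [0, 2, 5, 7, 9, 12], [0, 2, 6, 8, 15, 17], [0, 2,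
    11, 14, 20, 21], [0, 3, 4, 6, 7, 14], [0, 3, 5, 8, 11, 16], [0, 3, 9, 13, 17, 20], [0, 4,
    5, 17, 19, 21], [0, 4, 8, 10, 12, 20], [0, 4, 9, 11, 15, 18], [0, 5, 10, 13, 14, 15], [0,
    6, 9, 10, 16, 21], [0, 6, 11, 12, 13, 19], [0, 7, 8, 13, 18, 21], [0, 7, 15, 16, 19, 20],
    [0, 12, 14, 16, 17, 18], [1, 2, 3, 7, 8, 20], [1, 2, 5, 11, 15, 19], [1, 2, 6, 10, 12, 14],
    [1, 2, 9, 17, 18, 21], [1, 3, 4, 5, 9, 10], [1, 3, 6, 16, 17, 19], [1, 3, 11, 13, 14, 18],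
    [1, 4, 6, 8, 11, 21], [1, 4, 7, 12, 18, 19], [1, 4, 14, 15, 17, 20], [1, 5, 7, 14, 16, 21],
    [1, 5, 8, 12, 13, 17], [1, 6, 7, 9, 13, 15], [1, 8, 10, 15, 16, 18], [1, 9, 11, 12, 16,
    20], [1, 10, 13, 19, 20, 21], [2, 3, 4, 11, 12, 17], [2, 3, 5, 6, 13, 21], [2, 3, 9, 14,
    15, 16], [2, 4, 5, 8, 14, 18], [2, 4, 6, 9, 19, 20], [2, 4, 7, 10, 15, 21], [2, 5, 10, 16,
    17, 20], [2, 6, 7, 11, 16, 18], [2, 7, 13, 14, 17, 19], [2, 8, 9, 10, 11, 13], [2, 8, 12,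
    16, 19, 21], [2, 12, 13, 15, 18, 20], [3, 4, 8, 13, 15, 19], [3, 4, 16, 18, 20, 21], [3, 5,
    7, 15, 17, 18], [3, 5, 12, 14, 19, 20], [3, 6, 8, 9, 12, 18], [3, 6, 10, 11, 15, 20], [3,
    7, 9, 11, 19, 21], [3, 7, 10, 12, 13, 16], [3, 8, 10, 14, 17, 21], [4, 5, 6, 12, 15, 16],
    [4, 5, 7, 11, 13, 20], [4, 6, 10, 13, 17, 18], [4, 7, 8, 9, 16, 17], [4, 9, 12, 13, 14,
    21], [4, 10, 11, 14, 16, 19], [5, 6, 7, 8, 10, 19], [5, 6, 9, 11, 14, 17], [5, 8, 9, 15,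
    20, 21], [5, 9, 13, 16, 18, 19], [5, 10, 11, 12, 18, 21], [6, 7, 12, 17, 20, 21], [6, 8,
    13, 14, 16, 20], [6, 14, 15, 18, 19, 21], [7, 8, 11, 12, 14, 15], [7, 9, 10, 14, 18, 20],
    [8, 11, 17, 18, 19, 20], [9, 10, 12, 15, 17, 19], [11, 13, 15, 16, 17, 21]]

/-- For each point, the set of hexads through it, as a binary number. -/
def pointMasks : List ℕ :=
  [2097151, 137436856351, 562812545925601, 287668388507946530, 18160210383351083521,
    572720522989855085636, 4188879098285612270212, 14778834702179620356680,
    24887117496008172643472, 47488881883912823982160, 47547870042320424509480,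
    99511591497707143972104, 43391727968541469712450, 76892443375425450051585,
    17759751512588578489104, 120494441635444846805122, 76897920095866855162881,
    132857055994481258535048, 31139269603009848688676, 59204866378107617677360,
    30179473701813422139652, 78883070760567037038850]

/-- The column of `golayColumns` at a point. -/
def golayColumn (i : Fin 22) : ℕ := golayColumns.getD i 0

/-- The points of the hexad of index `h`. -/
def hexad (h : Fin 77) (j : Fin 6) : Fin 22 := Fin.ofNat 22 ((hexadList.getD h []).getD j 0)

/-- The set of hexads through a point, as a binary number. -/
def pointMask (i : Fin 22) : ℕ := pointMasks.getD i 0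

/-- The sign encoded by the binary digit of `n` of index `b`. -/
def bitSign (n b : ℕ) : ℤ := if n.testBit b then -1 else 1

/-- The sign vector of the coset word with information digits `x`. -/
def golaySign (x : Fin 10 → Bool) (i : Fin 22) : ℤ :=
  bitSign (golayColumn i) 10 * ∏ b : Fin 10, if x b then bitSign (golayColumn i) b else 1

/-- Incidence of a hexad and a point. -/
def incidence (h : Fin 77) (i : Fin 22) : Bool := (pointMask i).testBit h

theorem incidence_iff : ∀ h : Fin 77, ∀ i : Fin 22,
    incidence h i = true ↔ ∃ j, hexad h j = i := by decide +kernel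

/-- Search through the sets of at most `k` points below `n`: those on which the columns, added to
`acc`, have vanishing information digits must complete `l` to a hexad or be empty with `l`. -/
def dualCheck : ℕ → ℕ → ℕ → List ℕ → Bool
  | 0, _, acc, l => acc % 1024 != 0 || l.isEmpty || hexadList.contains l
  | n + 1, k, acc, l =>
    (Nat.blt n 10 && acc.testBit n || dualCheck n k acc l) &&
    (Nat.blt n 10 && !acc.testBit n || Nat.beq k 0 ||
      dualCheck n (k - 1) (acc ^^^ golayColumns.getD n 0) (n :: l))

theorem dualCheck_golay : dualCheck 22 6 0 [] = true := by decide +kernel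

/-- Every sum of `w` and some of the given rows has an admissible sum of signs. -/
def weightCheck : List ℕ → ℕ → Bool
  | [], w => decide (4 + ∑ i : Fin 22, bitSign w i ∈ [12, 4, -4])
  | r :: L, w => weightCheck L w && weightCheck L (w ^^^ r)

theorem weightCheck_golay : weightCheck golayRows 1211392 = true := by decide +kernel

theorem pointMask_lt : ∀ i : Fin 22, pointMask i < 2 ^ 77 := by decide +kernel

theorem pointMask_land : ∀ k : Fin 22, ∀ j < k, ∀ i < j,
    pointMask i &&& pointMask j &&& pointMask k =
      2 ^ Nat.log2 (pointMask i &&& pointMask j &&& pointMask k) := by decide +kernel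

theorem hexad_injective : ∀ h : Fin 77, Function.Injective (hexad h) := by decide +kernel

/-- The even sign patterns on six points, up to a global sign. -/
def evenSign (σ : Fin 16) (j : Fin 6) : ℤ :=
  bitSign (([0, 48, 12, 3, 40, 24, 36, 20, 34, 18, 17, 33, 10, 5, 6, 9] : List ℕ).getD σ 0) j

theorem sum_evenSign_pow_six (y : Fin 6 → ℝ) :
    ∑ σ, (∑ j, (evenSign σ j : ℝ) * y j) ^ 6 =
      16 * (15 * (∑ j, y j ^ 2) ^ 3 - 30 * (∑ j, y j ^ 2) * (∑ j, y j ^ 4) + 16 * ∑ j, y j ^ 6 +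
        720 * ∏ j, y j) := by
  have sum_signs (x y z : ℝ) : (x + y + z) ^ 6 + (x + y - z) ^ 6 + (x - y + z) ^ 6 +
      (-x + y + z) ^ 6 = 4 * ((x ^ 2) ^ 3 + (y ^ 2) ^ 3 + (z ^ 2) ^ 3 + 15 * ((x ^ 2) ^ 2 * y ^ 2 +
        (x ^ 2) ^ 2 * z ^ 2 + (y ^ 2) ^ 2 * x ^ 2 + (y ^ 2) ^ 2 * z ^ 2 + (z ^ 2) ^ 2 * x ^ 2 +
        (z ^ 2) ^ 2 * y ^ 2) + 90 * x ^ 2 * y ^ 2 * z ^ 2) := by ring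
  have pairs (a b c d e f : ℝ) : ∑ σ, (∑ j, (evenSign σ j : ℝ) * ![a, b, c, d, e, f] j) ^ 6 =
      (((a + b) + (c + d) + (e + f)) ^ 6 + ((a + b) + (c + d) - (e + f)) ^ 6 +
        ((a + b) - (c + d) + (e + f)) ^ 6 + (-(a + b) + (c + d) + (e + f)) ^ 6) +
      (((a + b) + (c - d) + (e - f)) ^ 6 + ((a + b) + (c - d) - (e - f)) ^ 6 +
        ((a + b) - (c - d) + (e - f)) ^ 6 + (-(a + b) + (c - d) + (e - f)) ^ 6) +
      (((a - b) + (c + d) + (e - f)) ^ 6 + ((a - b) + (c + d) - (e - f)) ^ 6 +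
        ((a - b) - (c + d) + (e - f)) ^ 6 + (-(a - b) + (c + d) + (e - f)) ^ 6) +
      (((a - b) + (c - d) + (e + f)) ^ 6 + ((a - b) + (c - d) - (e + f)) ^ 6 +
        ((a - b) - (c - d) + (e + f)) ^ 6 + (-(a - b) + (c - d) + (e + f)) ^ 6) := by
    have neg_six (x : ℝ) : (-x) ^ 6 = x ^ 6 := by ring
    have linear (σ : Fin 16) : ∑ j, (evenSign σ j : ℝ) * ![a, b, c, d, e, f] j =
        ![(a + b) + (c + d) + (e + f), (a + b) + (c + d) - (e + f), (a + b) - (c + d) + (e + f),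
          -(a + b) + (c + d) + (e + f), (a + b) + (c - d) + (e - f), (a + b) + (c - d) - (e - f),
          (a + b) - (c - d) + (e - f), -(-(a + b) + (c - d) + (e - f)),
          (a - b) + (c + d) + (e - f), (a - b) + (c + d) - (e - f),
          -((a - b) - (c + d) + (e - f)), -(a - b) + (c + d) + (e - f),
          (a - b) + (c - d) + (e + f), -((a - b) + (c - d) - (e + f)),
          (a - b) - (c - d) + (e + f), -(a - b) + (c - d) + (e + f)] σ := by
      fin_cases σ <;>
        simp [Fin.sum_univ_succ, evenSign, bitSign, Nat.testBit_eq_decide_div_mod_eq] <;> ring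
    simp_rw [linear]
    simp only [Fin.sum_univ_succ, Fin.sum_univ_zero, Matrix.cons_val_zero, Matrix.cons_val_succ,
      neg_six]
    abel
  obtain ⟨a, b, c, d, e, f, rfl⟩ : ∃ a b c d e f, y = ![a, b, c, d, e, f] :=
    ⟨y 0, y 1, y 2, y 3, y 4, y 5, by ext j; fin_cases j <;> rfl⟩
  rw [pairs]
  simp only [sum_signs, Fin.sum_univ_six, Fin.prod_univ_six]
  simp
  ring

theorem sum_hexad (h : Fin 77) (f : Fin 22 → ℝ) :
    ∑ j, f (hexad h j) = ∑ i, (if incidence h i then 1 else 0) * f i := by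
  rw [← Finset.sum_image (s := univ) (g := hexad h) (f := f)
    fun a _ b _ hab => hexad_injective h hab]
  simp only [ite_mul, one_mul, zero_mul]
  rw [← Finset.sum_filter]
  refine Finset.sum_congr ?_ fun _ _ => rfl
  ext i
  simp [incidence_iff]

theorem sum_incidence (h : Fin 77) : ∑ i, (if incidence h i then 1 else 0 : ℕ) = 6 := by
  have h1 := sum_hexad h fun _ => 1
  simp only [mul_one, sum_const, card_univ, Fintype.card_fin, nsmul_eq_mul] at h1
  exact_mod_cast h1.symm

theorem hexads_through_lt {i j k : Fin 22} (hij : i < j) (hjk : j < k) :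
    ∑ h, (if incidence h i && incidence h j && incidence h k then 1 else 0 : ℕ) = 1 := by
  have h3 := pointMask_land k j hjk i hij
  generalize Nat.log2 (pointMask i &&& pointMask j &&& pointMask k) = l at h3
  have hlt : l < 77 := by
    rw [← Nat.pow_lt_pow_iff_right (a := 2) (by norm_num), ← h3]
    exact (Nat.and_le_left.trans Nat.and_le_left).trans_lt (pointMask_lt i)
  have h4 (h : Fin 77) :
      (incidence h i && incidence h j && incidence h k) = true ↔ h = ⟨l, hlt⟩ := by
    have : (incidence h i && incidence h j && incidence h k) = (2 ^ l).testBit h := by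
      simp [incidence, ← h3, Nat.testBit_and]
    rw [this, Nat.testBit_two_pow, Fin.ext_iff]
    simp [eq_comm]
  simp only [h4]
  simp

/-- Three distinct points lie on exactly one hexad. -/
theorem hexads_through_distinct {i j k : Fin 22} (hij : i ≠ j) (hjk : j ≠ k) (hik : i ≠ k) :
    ∑ h, (if incidence h i && incidence h j && incidence h k then 1 else 0 : ℕ) = 1 := by
  have swap₁ (i j k : Fin 22) (h : Fin 77) : (incidence h i && incidence h j && incidence h k) =
      (incidence h j && incidence h i && incidence h k) := by
    rw [Bool.and_comm (incidence h i)]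
  have swap₂ (i j k : Fin 22) (h : Fin 77) : (incidence h i && incidence h j && incidence h k) =
      (incidence h i && incidence h k && incidence h j) := by
    rw [Bool.and_right_comm]
  rcases hij.lt_or_gt with h1 | h1 <;> rcases hjk.lt_or_gt with h2 | h2 <;>
    rcases hik.lt_or_gt with h3 | h3
  · exact hexads_through_lt h1 h2
  · exact absurd (h1.trans h2) h3.asymm
  · simp only [swap₂ i j k]
    exact hexads_through_lt h3 h2
  · simp only [swap₂ i j k, swap₁ i k j]
    exact hexads_through_lt h3 h1
  · simp only [swap₁ i j k]
    exact hexads_through_lt h1 h3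
  · simp only [swap₁ i j k, swap₂ j i k]
    exact hexads_through_lt h2 h3
  · exact absurd (h2.trans h1) h3.asymm
  · simp only [swap₁ i j k, swap₂ j i k, swap₁ j k i]
    exact hexads_through_lt h2 h1

theorem hexads_through_two {i j : Fin 22} (hij : i ≠ j) :
    ∑ h, (if incidence h i && incidence h j then 1 else 0 : ℕ) = 5 := by
  set N := ∑ h, (if incidence h i && incidence h j then 1 else 0 : ℕ) with hN
  have h1 : N * 6 = ∑ k, ∑ h,
      (if incidence h i && incidence h j && incidence h k then 1 else 0 : ℕ) := by
    rw [hN, sum_mul, sum_comm]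
    refine sum_congr rfl fun h _ => ?_
    rw [← sum_incidence h, mul_sum]
    refine sum_congr rfl fun k _ => ?_
    cases incidence h i <;> cases incidence h j <;> cases incidence h k <;> rfl
  have h2 (k : Fin 22) :
      ∑ h, (if incidence h i && incidence h j && incidence h k then 1 else 0 : ℕ) +
        ((if i = k then 1 else 0) + (if j = k then 1 else 0)) =
      1 + N * ((if i = k then 1 else 0) + (if j = k then 1 else 0)) := by
    by_cases hik : i = k
    · subst hik
      have h3 (h : Fin 77) : (incidence h i && incidence h j && incidence h i) =
          (incidence h i && incidence h j) := by
        cases incidence h i <;> cases incidence h j <;> rfl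
      simp only [h3, hij.symm, ← hN, if_true, if_false]
      ring
    by_cases hjk : j = k
    · subst hjk
      simp only [Bool.and_assoc, Bool.and_self, hij, ← hN, if_true, if_false]
      ring
    rw [hexads_through_distinct hij hjk hik]
    simp [hik, hjk]
  have h3 := sum_congr (rfl : (univ : Finset (Fin 22)) = univ) fun k _ => h2 k
  simp only [sum_add_distrib, ← mul_sum, sum_ite_eq, mem_univ, if_true, ← h1, sum_const, card_univ,
    Fintype.card_fin, smul_eq_mul] at h3
  omega

theorem hexads_through_one (i : Fin 22) :
    ∑ h, (if incidence h i then 1 else 0 : ℕ) = 21 := by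
  set N := ∑ h, (if incidence h i then 1 else 0 : ℕ) with hN
  have h1 : N * 6 = ∑ j, ∑ h, (if incidence h i && incidence h j then 1 else 0 : ℕ) := by
    rw [hN, sum_mul, sum_comm]
    refine sum_congr rfl fun h _ => ?_
    rw [← sum_incidence h, mul_sum]
    refine sum_congr rfl fun k _ => ?_
    cases incidence h i <;> cases incidence h k <;> rfl
  have h2 (j : Fin 22) : ∑ h, (if incidence h i && incidence h j then 1 else 0 : ℕ) +
      (if i = j then 5 else 0) = 5 + if i = j then N else 0 := by
    by_cases hij : i = j
    · subst hij
      simp only [Bool.and_self, ← hN, if_true]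
      ring
    · simp only [hexads_through_two hij, hij, if_false]
  have h3 := sum_congr (rfl : (univ : Finset (Fin 22)) = univ) fun k _ => h2 k
  simp only [sum_add_distrib, sum_ite_eq, mem_univ, if_true, ← h1, sum_const, card_univ,
    Fintype.card_fin, smul_eq_mul] at h3
  omega

theorem hexads_through_three (i j k : Fin 22) :
    ∑ h, (if incidence h i && incidence h j && incidence h k then 1 else 0 : ℕ) =
      1 + 4 * ((if i = j then 1 else 0) + (if j = k then 1 else 0) + (if i = k then 1 else 0)) +
        (if i = j ∧ j = k then 8 else 0) := by
  by_cases hij : i = j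
  · subst hij
    by_cases hik : i = k
    · subst hik
      simp only [Bool.and_self, hexads_through_one]
      simp
    · simp only [Bool.and_self, hexads_through_two hik]
      simp [hik]
  by_cases hjk : j = k
  · subst hjk
    simp only [Bool.and_assoc, Bool.and_self, hexads_through_two hij]
    simp [hij]
  by_cases hik : i = k
  · subst hik
    have h2 (h : Fin 77) : (incidence h i && incidence h j && incidence h i) =
        (incidence h i && incidence h j) := by
      cases incidence h i <;> cases incidence h j <;> rfl
    simp only [h2, hexads_through_two hij]
    simp [hij, hjk]
  · rw [hexads_through_distinct hij hjk hik]
    simp [hij, hjk, hik]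

theorem sum_hexads_mul (a b c : Fin 22 → ℝ) :
    ∑ h, (∑ j, a (hexad h j)) * (∑ j, b (hexad h j)) * (∑ j, c (hexad h j)) =
      (∑ i, a i) * (∑ i, b i) * (∑ i, c i) +
      4 * ((∑ i, a i * b i) * (∑ i, c i) + (∑ i, a i) * (∑ i, b i * c i) +
        (∑ i, a i * c i) * (∑ i, b i)) + 8 * ∑ i, a i * b i * c i := by
  have key (i j k : Fin 22) :
      ∑ h, ((if incidence h i then 1 else 0 : ℝ) * (if incidence h j then 1 else 0) *
        (if incidence h k then 1 else 0)) =
      1 + 4 * ((if i = j then 1 else 0) + (if j = k then 1 else 0) + (if i = k then 1 else 0)) +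
        8 * ((if i = j then 1 else 0) * (if j = k then 1 else 0)) := by
    have := congrArg (Nat.cast : ℕ → ℝ) (hexads_through_three i j k)
    push_cast at this
    calc _ = _ := Finset.sum_congr rfl fun h _ => ?_
      _ = _ := this
      _ = _ := by split_ifs <;> simp_all
    cases incidence h i <;> cases incidence h j <;> cases incidence h k <;> simp
  have e1 : ∑ i, ∑ j, ∑ k, a i * b j * c k = (∑ i, a i) * (∑ i, b i) * (∑ i, c i) := by
    simp only [← Finset.mul_sum, ← Finset.sum_mul]
  have e2 : ∑ i, ∑ j, ∑ k, a i * b j * c k * (if i = j then 1 else 0) =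
      (∑ i, a i * b i) * (∑ i, c i) := by
    simp [← Finset.mul_sum, Finset.sum_mul]
  have e3 : ∑ i, ∑ j, ∑ k, a i * b j * c k * (if j = k then 1 else 0) =
      (∑ i, a i) * (∑ i, b i * c i) := by
    simp [Finset.sum_mul_sum, mul_assoc]
  have e4 : ∑ i, ∑ j, ∑ k, a i * b j * c k * (if i = k then 1 else 0) =
      (∑ i, a i * c i) * (∑ i, b i) := by
    simp [Finset.sum_mul_sum, mul_right_comm]
  have e5 : ∑ i, ∑ j, ∑ k, a i * b j * c k * ((if i = j then 1 else 0) * (if j = k then 1 else 0)) =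
      ∑ i, a i * b i * c i := by
    simp
  calc _ = ∑ i, ∑ j, ∑ k, a i * b j * c k * ∑ h, ((if incidence h i then 1 else 0 : ℝ) *
          (if incidence h j then 1 else 0) * (if incidence h k then 1 else 0)) := by
        simp_rw [sum_hexad, Finset.sum_mul_sum, Finset.sum_mul, Finset.mul_sum]
        rw [Finset.sum_comm]
        refine Finset.sum_congr rfl fun i _ => ?_
        rw [Finset.sum_comm, Finset.sum_congr rfl fun _ _ => Finset.sum_comm, Finset.sum_comm]
        refine Finset.sum_congr rfl fun j _ => ?_
        refine Finset.sum_congr rfl fun k _ => ?_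
        refine Finset.sum_congr rfl fun h _ => ?_
        ring
    _ = _ := by
        rw [← e1, ← e2, ← e3, ← e4, ← e5]
        simp_rw [key, Finset.mul_sum, ← Finset.sum_add_distrib, Finset.mul_sum,
          ← Finset.sum_add_distrib]
        refine Finset.sum_congr rfl fun i _ => Finset.sum_congr rfl fun j _ =>
          Finset.sum_congr rfl fun k _ => ?_
        ring

theorem sum_hexad_evenSign_pow_six (v : Fin 22 → ℝ) :
    ∑ h, ∑ σ, (2 * ∑ j, (evenSign σ j : ℝ) * v (hexad h j)) ^ 6 =
      1024 * (15 * (∑ i, v i ^ 2) ^ 3 + 30 * (∑ i, v i ^ 2) * (∑ i, v i ^ 4) - 24 * ∑ i, v i ^ 6 +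
        720 * ∑ h, ∏ j, v (hexad h j)) := by
  have h1 := sum_hexads_mul (fun i => v i ^ 2) (fun i => v i ^ 2) (fun i => v i ^ 2)
  have h2 := sum_hexads_mul (fun i => v i ^ 2) (fun i => v i ^ 4) (fun _ => 1)
  have h3 := sum_hexads_mul (fun i => v i ^ 6) (fun _ => 1) (fun _ => 1)
  simp only [Finset.sum_const, Finset.card_univ, Fintype.card_fin, nsmul_eq_mul, mul_one,
    ← pow_add, ← Finset.sum_mul, Nat.reduceAdd] at h1 h2 h3
  simp_rw [mul_pow, ← Finset.mul_sum, sum_evenSign_pow_six]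
  simp only [← Finset.mul_sum, Finset.sum_add_distrib, Finset.sum_sub_distrib, mul_assoc]
  simp only [← mul_assoc, ← pow_three'] at h1 h2 h3 ⊢
  push_cast at h1 h2 h3
  linear_combination (1024 * 15) * h1 - 1024 * 5 * h2 + 1024 * 16 / 36 * h3

theorem bitSign_xor (m n b : ℕ) : bitSign (m ^^^ n) b = bitSign m b * bitSign n b := by
  simp only [bitSign, Nat.testBit_xor]
  cases m.testBit b <;> cases n.testBit b <;> simp

theorem bitSign_mul_self (n b : ℕ) : bitSign n b * bitSign n b = 1 := by
  unfold bitSign; split_ifs <;> rfl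

theorem bitSign_eq_one_iff (n b : ℕ) : bitSign n b = 1 ↔ n.testBit b = false := by
  unfold bitSign; split_ifs with h <;> simp [h]

theorem golayColumns_systematic :
    ∀ b < 10, bitSign (golayColumns.getD b 0) b = -1 ∧
      ∀ i < b, bitSign (golayColumns.getD i 0) b = 1 := by decide +kernel

theorem eq_empty_or_hexad_of_dualCheck (n : ℕ) : ∀ (k acc : ℕ) (l : List ℕ),
    dualCheck n k acc l = true → ∀ S ⊆ range n, S.card ≤ k →
    (∀ b < 10, bitSign acc b * ∏ i ∈ S, bitSign (golayColumns.getD i 0) b = 1) →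
    l.toFinset ∪ S = ∅ ∨ ∃ L ∈ hexadList, l.toFinset ∪ S = L.toFinset := by
  induction n with
  | zero =>
    intro k acc l hl S hS _ hb
    obtain rfl : S = ∅ := by simpa using hS
    simp only [prod_empty, mul_one, bitSign_eq_one_iff] at hb
    have h0 : acc % 1024 = 0 := by
      refine Nat.eq_of_testBit_eq fun b => ?_
      rw [show 1024 = 2 ^ 10 from rfl, Nat.testBit_mod_two_pow]
      by_cases h : b < 10 <;> simp [h, hb]
    simp only [dualCheck, h0, bne_self_eq_false, Bool.false_or, Bool.or_eq_true,
      List.isEmpty_iff, List.contains_iff_mem] at hl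
    rcases hl with rfl | hl
    · simp
    · exact Or.inr ⟨l, hl, by simp⟩
  | succ n ih =>
    intro k acc l hl S hS hk hb
    have hbit (hn : n < 10) : bitSign acc n = if n ∈ S then -1 else 1 := by
      have hone : ∏ i ∈ S.erase n, bitSign (golayColumns.getD i 0) n = 1 := by
        refine prod_eq_one fun i hi => (golayColumns_systematic n hn).2 i ?_
        have := hS (mem_of_mem_erase hi)
        have := ne_of_mem_erase hi
        simp at *; omega
      have h1 := hb n hn
      split_ifs with h
      · rw [← mul_prod_erase S _ h, hone, (golayColumns_systematic n hn).1] at h1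
        linarith
      · rw [erase_eq_of_notMem h] at hone
        rwa [hone, mul_one] at h1
    simp only [dualCheck, Bool.and_eq_true, Bool.or_eq_true, Nat.blt_eq, Bool.not_eq_true',
      Nat.beq_eq] at hl
    by_cases h : n ∈ S
    · have hk0 : k ≠ 0 := by
        rintro rfl
        simp [card_eq_zero.mp (Nat.le_zero.mp hk)] at h
      have h2 := hl.2
      have hnb : ¬ (n < 10 ∧ acc.testBit n = false) := by
        rintro ⟨h3, h4⟩
        rw [← bitSign_eq_one_iff, hbit h3, if_pos h] at h4
        norm_num at h4
      have h3 := ih (k - 1) _ _ ((h2.resolve_left fun h => h.elim hnb hk0)) (S.erase n)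
        (by
          intro i hi
          have := hS (mem_of_mem_erase hi)
          have := ne_of_mem_erase hi
          simp at *; omega)
        (by rw [card_erase_of_mem h]; omega)
        (by
          intro b hb'
          rw [bitSign_xor, mul_assoc,
            mul_prod_erase S (fun i => bitSign (golayColumns.getD i 0) b) h]
          exact hb b hb')
      rwa [List.toFinset_cons, insert_union, ← union_insert, insert_erase h] at h3
    · have hnb : ¬ (n < 10 ∧ acc.testBit n = true) := by
        rintro ⟨h3, h4⟩
        have := hbit h3
        rw [if_neg h, bitSign_eq_one_iff, h4] at this
        simp at this
      refine ih k acc l (hl.1.resolve_left hnb) S ?_ hk hb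
      intro i hi
      have := hS hi
      have : i ≠ n := fun h' => h (h' ▸ hi)
      simp at *; omega

/-- The set of points of a hexad. -/
def hexadSet (h : Fin 77) : Finset (Fin 22) := univ.image (hexad h)

theorem hexadSet_injective : Function.Injective hexadSet := by
  intro a b hab
  have hmem (j : Fin 6) : incidence b (hexad a j) = true := by
    have : hexad a j ∈ hexadSet b := hab ▸ mem_image_of_mem _ (mem_univ j)
    simpa [incidence_iff, hexadSet] using this
  have hmem' (j : Fin 6) : incidence a (hexad a j) = true := (incidence_iff _ _).mpr ⟨j, rfl⟩
  have hne (i j : Fin 6) (h : i ≠ j) : hexad a i ≠ hexad a j := (hexad_injective a).ne h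
  have h1 := hexads_through_distinct (hne 0 1 (by decide)) (hne 1 2 (by decide))
    (hne 0 2 (by decide))
  rw [← card_filter] at h1
  exact card_le_one.mp h1.le a (by simp [hmem']) b (by simp [hmem])

theorem hexadList_eq_ofFn : ∀ h : Fin hexadList.length,
    hexadList.get h = List.ofFn fun j => (hexad h j : ℕ) := by
  decide +kernel

theorem hexadList_toFinset (L : List ℕ) (hL : L ∈ hexadList) : ∃ h : Fin 77,
    L.toFinset = univ.image fun j => (hexad h j : ℕ) := by
  obtain ⟨h, rfl⟩ := List.mem_iff_get.mp hL
  refine ⟨h, ?_⟩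
  rw [hexadList_eq_ofFn]
  ext i
  rw [List.mem_toFinset, List.mem_ofFn]
  simp

theorem golaySign_hexad : ∀ h : Fin 77, ∏ j, bitSign (golayColumn (hexad h j)) 10 = -1 ∧
    ∀ b : Fin 10, ∏ j, bitSign (golayColumn (hexad h j)) b = 1 := by
  decide +kernel

theorem sum_prod_golaySign (S : Finset (Fin 22)) (hS : S.card ≤ 6) :
    ∑ x, ∏ i ∈ S, golaySign x i =
      1024 * ((if S = ∅ then 1 else 0) - ∑ h, if S = hexadSet h then 1 else 0) := by
  have hsum : ∑ x, ∏ i ∈ S, golaySign x i = (∏ i ∈ S, bitSign (golayColumn i) 10) *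
      ∏ b : Fin 10, (1 + ∏ i ∈ S, bitSign (golayColumn i) b) := by
    have h1 (b : Fin 10) : 1 + ∏ i ∈ S, bitSign (golayColumn i) b =
        ∑ t : Bool, if t then ∏ i ∈ S, bitSign (golayColumn i) b else 1 := by
      simp [add_comm]
    simp_rw [h1]
    rw [Finset.prod_univ_sum, Fintype.piFinset_univ, Finset.mul_sum]
    refine sum_congr rfl fun x _ => ?_
    simp_rw [golaySign, prod_mul_distrib]
    rw [Finset.prod_comm]
    congr 1
    refine prod_congr rfl fun b _ => ?_
    split_ifs <;> simp
  rw [hsum]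
  by_cases h0 : S = ∅
  · subst h0
    have (h : Fin 77) : ∅ ≠ hexadSet h :=
      (ne_empty_of_mem (mem_image_of_mem (hexad h) (mem_univ 0))).symm
    simp [this]
  by_cases hall : ∀ b : Fin 10, ∏ i ∈ S, bitSign (golayColumn i) b = 1
  · obtain ⟨h, rfl⟩ : ∃ h, S = hexadSet h := by
      rcases eq_empty_or_hexad_of_dualCheck 22 6 0 [] dualCheck_golay (S.map Fin.valEmbedding)
        (by intro i; simp; omega) (by simpa using hS)
        (by intro b hb; simpa [bitSign, golayColumn] using hall ⟨b, hb⟩) with h | ⟨L, hL, h⟩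
      · simp [h0] at h
      · obtain ⟨a, ha⟩ := hexadList_toFinset L hL
        refine ⟨a, Finset.map_injective Fin.valEmbedding ?_⟩
        rw [hexadSet, Finset.map_eq_image, Finset.map_eq_image, Finset.image_image]
        rw [ha, Finset.map_eq_image] at h
        simpa [Function.comp_def] using h
    simp_rw [hall]
    have hin (f : Fin 22 → ℤ) : ∏ i ∈ hexadSet h, f i = ∏ j, f (hexad h j) :=
      prod_image fun a _ b _ hab => hexad_injective h hab
    rw [hin, (golaySign_hexad h).1, if_neg h0]
    simp [hexadSet_injective.eq_iff]
  · push Not at hall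
    obtain ⟨b, hb⟩ := hall
    have hb' : 1 + ∏ i ∈ S, bitSign (golayColumn i) b = 0 := by
      have : (∏ i ∈ S, bitSign (golayColumn i) b) * (∏ i ∈ S, bitSign (golayColumn i) b) = 1 := by
        rw [← prod_mul_distrib]
        exact prod_eq_one fun i _ => bitSign_mul_self _ _
      rcases mul_self_eq_one_iff.mp this with h | h
      · exact absurd h hb
      · rw [h]; norm_num
    have hne (h : Fin 77) : S ≠ hexadSet h := by
      rintro rfl
      apply hb
      rw [hexadSet, prod_image fun a _ b _ hab => hexad_injective h hab]
      exact (golaySign_hexad h).2 b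
    rw [prod_eq_zero (mem_univ b) hb']
    simp [h0, hne]

theorem sum_prod_sign (S : Finset (Fin 22)) :
    ∑ y : Fin 22 → Bool, ∏ i ∈ S, (if y i then -1 else 1 : ℤ) = if S = ∅ then 2 ^ 22 else 0 := by
  have h1 (y : Fin 22 → Bool) : ∏ i ∈ S, (if y i then -1 else 1 : ℤ) =
      ∏ i, if i ∈ S then (if y i then -1 else 1) else 1 := by
    simp
  simp_rw [h1]
  have := (Finset.prod_univ_sum (fun _ : Fin 22 => (univ : Finset Bool))
    (fun i t => if i ∈ S then (if t then -1 else 1 : ℤ) else 1)).symm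
  rw [Fintype.piFinset_univ] at this
  rw [this]
  split_ifs with h
  · simp [h]
  · obtain ⟨i, hi⟩ := nonempty_iff_ne_empty.mpr h
    exact prod_eq_zero (mem_univ i) (by simp [hi])

theorem sum_signs_pow_six (n : ℕ) : ∀ (x : ℝ) (v : Fin n → ℝ),
    ∑ y : Fin n → Bool, (x + ∑ i, (if y i then -1 else 1) * v i) ^ 6 =
      2 ^ n * (x ^ 6 + 15 * x ^ 4 * ∑ i, v i ^ 2 +
        15 * x ^ 2 * (3 * (∑ i, v i ^ 2) ^ 2 - 2 * ∑ i, v i ^ 4) +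
        15 * (∑ i, v i ^ 2) ^ 3 - 30 * (∑ i, v i ^ 2) * (∑ i, v i ^ 4) + 16 * ∑ i, v i ^ 6) := by
  induction n with
  | zero => intro x v; simp
  | succ n ih =>
    intro x v
    rw [← (Fin.consEquiv fun _ => Bool).sum_comp, Fintype.sum_prod_type, Fintype.sum_bool]
    simp only [Fin.consEquiv_apply, Fin.sum_univ_succ, Fin.cons_zero, Fin.cons_succ, ← add_assoc,
      ih]
    simp
    ring

theorem prod_pow_eq_prod_odd (e : Fin 22 → ℝ) (he : ∀ i, e i ^ 2 = 1) (k : Fin 22 → ℕ) :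
    ∏ i, e i ^ k i = ∏ i with Odd (k i), e i := by
  rw [prod_filter]
  refine prod_congr rfl fun i _ => ?_
  split_ifs with h
  · obtain ⟨m, hm⟩ := h
    rw [hm, pow_add, pow_mul, he, one_pow, one_mul, pow_one]
  · obtain ⟨m, hm⟩ := Nat.not_odd_iff_even.mp h
    rw [hm, ← two_mul, pow_mul, he, one_pow]

theorem card_odd_le_sum (k : Fin 22 → ℕ) : (univ.filter fun i => Odd (k i)).card ≤ ∑ i, k i := by
  rw [card_filter]
  refine sum_le_sum fun i _ => ?_
  split_ifs with h
  · exact h.pos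
  · exact Nat.zero_le _

theorem sum_pow_signs {X : Type*} [Fintype X] (e : X → Fin 22 → ℝ) (he : ∀ x i, e x i ^ 2 = 1)
    (v : Fin 22 → ℝ) (m : ℕ) :
    ∑ x, (∑ i, e x i * v i) ^ m =
      ∑ k ∈ piAntidiag univ m, (Nat.multinomial univ k * ∏ i, v i ^ k i) *
        ∑ x, ∏ i with Odd (k i), e x i := by
  simp_rw [sum_pow_eq_sum_piAntidiag, mul_pow, prod_mul_distrib, prod_pow_eq_prod_odd _ (he _)]
  rw [sum_comm]
  refine sum_congr rfl fun k _ => ?_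
  rw [mul_sum]
  exact sum_congr rfl fun x _ => by ring

theorem golaySign_mul_self (x : Fin 10 → Bool) (i : Fin 22) :
    golaySign x i * golaySign x i = 1 := by
  rw [golaySign, mul_mul_mul_comm, bitSign_mul_self, one_mul, ← prod_mul_distrib]
  refine prod_eq_one fun b _ => ?_
  split_ifs
  · exact bitSign_mul_self _ _
  · rfl

theorem sum_golaySign_pow (v : Fin 22 → ℝ) (m : ℕ) (hm : m ≤ 6) :
    ∑ x, (∑ i, (golaySign x i : ℝ) * v i) ^ m =
      1024 / 2 ^ 22 * ∑ y : Fin 22 → Bool, (∑ i, (if y i then -1 else 1) * v i) ^ m -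
        if m = 6 then 1024 * 720 * ∑ h, ∏ j, v (hexad h j) else 0 := by
  have hgolay (x : Fin 10 → Bool) (i : Fin 22) : (golaySign x i : ℝ) ^ 2 = 1 := by
    rw [sq]
    exact_mod_cast golaySign_mul_self x i
  rw [sum_pow_signs _ hgolay,
    sum_pow_signs (fun (y : Fin 22 → Bool) i => if y i then -1 else 1)
      (by intros; split_ifs <;> norm_num)]
  have hhex (h : Fin 77) : ∑ k ∈ piAntidiag univ m, (Nat.multinomial univ k * ∏ i, v i ^ k i) *
      (if (univ.filter fun i => Odd (k i)) = hexadSet h then 1 else 0) =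
      if m = 6 then 720 * ∏ j, v (hexad h j) else 0 := by
    have hcard : (hexadSet h).card = 6 := by
      simp [hexadSet, card_image_of_injective _ (hexad_injective h)]
    have hsum : ∑ i, (if i ∈ hexadSet h then 1 else 0) = 6 := by simp [hcard]
    have hodd : (univ.filter fun i => Odd (if i ∈ hexadSet h then 1 else 0)) = hexadSet h := by
      ext i
      by_cases hi : i ∈ hexadSet h <;> simp [hi]
    have hmult : Nat.multinomial univ (fun i => if i ∈ hexadSet h then 1 else 0) = 720 := by
      rw [Nat.multinomial, hsum, prod_eq_one fun i _ => by split_ifs <;> rfl]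
      rfl
    have hprod : ∏ i, v i ^ (if i ∈ hexadSet h then 1 else 0) = ∏ j, v (hexad h j) := by
      simp_rw [pow_ite, pow_one, pow_zero]
      rw [prod_ite_mem, univ_inter, hexadSet, prod_image fun a _ b _ hab => hexad_injective h hab]
    have huniq (k) (hk : k ∈ piAntidiag univ m)
        (ho : (univ.filter fun i => Odd (k i)) = hexadSet h) :
        m = 6 ∧ k = fun i => if i ∈ hexadSet h then 1 else 0 := by
      have hle (i) : (if i ∈ hexadSet h then 1 else 0) ≤ k i := by
        split_ifs with hi
        · rw [← ho, mem_filter] at hi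
          exact hi.2.pos
        · exact Nat.zero_le _
      have hkm := (mem_piAntidiag.mp hk).1
      have h6 : 6 ≤ m := by rw [← hkm, ← hsum]; exact sum_le_sum fun i _ => hle i
      have hm6 : m = 6 := le_antisymm hm h6
      refine ⟨hm6, funext fun i => ?_⟩
      exact ((sum_eq_sum_iff_of_le fun i _ => hle i).mp (by rw [hsum, hkm, hm6]) i
        (mem_univ i)).symm
    split_ifs with h6
    · rw [sum_eq_single_of_mem (fun i => if i ∈ hexadSet h then 1 else 0)
        (mem_piAntidiag.mpr ⟨by rw [h6]; exact hsum, fun _ _ => mem_univ _⟩)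
        fun k hk hne => by rw [if_neg fun ho => hne (huniq k hk ho).2, mul_zero]]
      rw [hodd, if_pos rfl, hmult, hprod]
      norm_num
    · exact sum_eq_zero fun k hk => by rw [if_neg fun ho => h6 (huniq k hk ho).1, mul_zero]
  have hk (k) (hk : k ∈ piAntidiag univ m) : ∑ x, ∏ i with Odd (k i), (golaySign x i : ℝ) =
      1024 / 2 ^ 22 * ∑ y : Fin 22 → Bool, ∏ i with Odd (k i), (if y i then -1 else 1 : ℝ) -
        1024 * ∑ h, if (univ.filter fun i => Odd (k i)) = hexadSet h then 1 else 0 := by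
    have h1 := congrArg (Int.cast : ℤ → ℝ) (sum_prod_golaySign (univ.filter fun i => Odd (k i))
      ((card_odd_le_sum k).trans ((mem_piAntidiag.mp hk).1.trans_le hm)))
    have h2 := congrArg (Int.cast : ℤ → ℝ) (sum_prod_sign (univ.filter fun i => Odd (k i)))
    push_cast at h1 h2
    rw [h1, h2]
    split_ifs <;> ring
  rw [sum_congr rfl fun k h => congrArg _ (hk k h)]
  simp_rw [mul_sub, sum_sub_distrib]
  congr 1
  · rw [mul_sum]
    exact sum_congr rfl fun k _ => by ring
  · simp_rw [mul_left_comm _ (1024 : ℝ), ← mul_sum, mul_sum univ]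
    rw [sum_comm, sum_congr rfl fun h _ => hhex h]
    split_ifs
    · rw [← mul_sum, ← mul_sum, mul_assoc]
    · simp

theorem sum_golaySign_pow_six (s : ℝ) (v : Fin 22 → ℝ) :
    ∑ x, (s + ∑ i, (golaySign x i : ℝ) * v i) ^ 6 =
      1024 * (s ^ 6 + 15 * s ^ 4 * ∑ i, v i ^ 2 +
        15 * s ^ 2 * (3 * (∑ i, v i ^ 2) ^ 2 - 2 * ∑ i, v i ^ 4) +
        15 * (∑ i, v i ^ 2) ^ 3 - 30 * (∑ i, v i ^ 2) * (∑ i, v i ^ 4) + 16 * ∑ i, v i ^ 6 -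
        720 * ∑ h, ∏ j, v (hexad h j)) := by
  have h := sum_signs_pow_six 22 s v
  have expand (a b : ℝ) : (a + b) ^ 6 = a ^ 6 * b ^ 0 + 6 * a ^ 5 * b ^ 1 + 15 * a ^ 4 * b ^ 2 +
    20 * a ^ 3 * b ^ 3 + 15 * a ^ 2 * b ^ 4 + 6 * a * b ^ 5 + b ^ 6 := by ring
  simp_rw [expand, sum_add_distrib, ← mul_sum] at h ⊢
  simp_rw [sum_golaySign_pow v _ (show 0 ≤ 6 by norm_num),
    sum_golaySign_pow v _ (show 1 ≤ 6 by norm_num), sum_golaySign_pow v _ (show 2 ≤ 6 by norm_num),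
    sum_golaySign_pow v _ (show 3 ≤ 6 by norm_num), sum_golaySign_pow v _ (show 4 ≤ 6 by norm_num),
    sum_golaySign_pow v _ (show 5 ≤ 6 by norm_num), sum_golaySign_pow v _ (show 6 ≤ 6 by norm_num)]
  norm_num only [if_true, if_false] at h ⊢
  linear_combination (1024 / 2 ^ 22) * h

/-- Indices of 2300 lines in `ℝ × ℝ²²`, spanned by the vectors of a tight spherical 7-design. -/
abbrev LineIndex : Type := (Fin 22 × Bool) ⊕ (Fin 77 × Fin 16) ⊕ (Fin 10 → Bool)

/-- The first coordinate, in units of `√2`, of a vector spanning a line. -/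
def axial : LineIndex → ℤ
  | .inl _ => 2
  | .inr (.inl _) => 0
  | .inr (.inr _) => 1

/-- The other coordinates of a vector spanning a line. -/
def transverse : LineIndex → Fin 22 → ℤ
  | .inl (i, s), k => if k = i then (if s then -4 else 4) else 0
  | .inr (.inl (h, σ)), k => 2 * ∑ j, if k = hexad h j then evenSign σ j else 0
  | .inr (.inr x), k => golaySign x k

/-- The inner product with the vector `(2√2, 1, …, 1)`. -/
def height (a : LineIndex) : ℤ := 4 * axial a + ∑ k, transverse a k

theorem card_lineIndex : Fintype.card LineIndex = 2300 := by
  simp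

theorem height_mem_of_weightCheck : ∀ (L : List ℕ) (w : ℕ), weightCheck L w = true →
    ∀ x : Fin L.length → Bool, 4 + ∑ i : Fin 22, bitSign w i *
      ∏ b, (if x b then bitSign (L.get b) i else 1) ∈ ([12, 4, -4] : List ℤ)
  | [], w, h, x => by simpa [weightCheck] using h
  | r :: L, w, h, x => by
    rw [weightCheck, Bool.and_eq_true] at h
    change Fin (L.length + 1) → Bool at x
    change 4 + ∑ i : Fin 22, bitSign w i *
      ∏ b : Fin (L.length + 1), (if x b then bitSign ((r :: L).get b) i else 1) ∈ _
    simp only [Fin.prod_univ_succ, ← mul_assoc]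
    by_cases hx : x 0 = true
    · simpa [hx, bitSign_xor] using height_mem_of_weightCheck L _ h.2 fun b => x b.succ
    · simpa [hx] using height_mem_of_weightCheck L _ h.1 fun b => x b.succ

theorem bitSign_golayRows : ∀ i : Fin 22, bitSign 1211392 i = bitSign (golayColumn i) 10 ∧
    ∀ b : Fin 10, bitSign (golayRows.get b) i = bitSign (golayColumn i) b := by
  decide +kernel

theorem height_evenSign (σ : Fin 16) : 2 * ∑ j, evenSign σ j ∈ ([12, 4, -4] : List ℤ) := by
  revert σ
  decide +kernel

theorem sum_transverse_hexad (h : Fin 77) (σ : Fin 16) (v : Fin 22 → ℝ) :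
    ∑ k, (transverse (.inr (.inl (h, σ))) k : ℝ) * v k =
      2 * ∑ j, (evenSign σ j : ℝ) * v (hexad h j) := by
  simp only [transverse]
  push_cast
  simp_rw [mul_assoc, sum_mul, ← mul_sum]
  rw [sum_comm]
  simp

theorem height_hexad (h : Fin 77) (σ : Fin 16) :
    height (.inr (.inl (h, σ))) = 2 * ∑ j, evenSign σ j := by
  simp only [height, axial, transverse, ← mul_sum]
  rw [sum_comm]
  simp

theorem height_mem (a : LineIndex) : height a ∈ ([12, 4, -4] : List ℤ) := by
  rcases a with ⟨i, s⟩ | ⟨h, σ⟩ | x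
  · cases s <;> simp [height, axial, transverse]
  · rw [height_hexad]
    exact height_evenSign σ
  · have h1 := height_mem_of_weightCheck golayRows 1211392 weightCheck_golay x
    simp only [(bitSign_golayRows _).1] at h1
    have h2 (i : Fin 22) : ∏ b : Fin 10, (if x b then bitSign (golayColumn i) b else 1) =
        ∏ b : Fin golayRows.length, (if x b then bitSign (golayRows.get b) i else 1) :=
      prod_congr rfl fun b _ => by rw [(bitSign_golayRows i).2 b]
    simp only [height, axial, transverse, golaySign, h2]
    exact h1

theorem height_ne_zero (a : LineIndex) : height a ≠ 0 := by
  have := height_mem a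
  intro h
  simp [h] at this

theorem transverse_hexad (h : Fin 77) (σ : Fin 16) (j : Fin 6) :
    transverse (.inr (.inl (h, σ))) (hexad h j) = 2 * evenSign σ j := by
  simp [transverse, (hexad_injective h).eq_iff]

theorem evenSign_mul_self (σ : Fin 16) (j : Fin 6) : evenSign σ j * evenSign σ j = 1 :=
  bitSign_mul_self _ _

theorem norm_transverse (a : LineIndex) : 2 * axial a ^ 2 + ∑ k, transverse a k ^ 2 = 24 := by
  rcases a with ⟨i, s⟩ | ⟨h, σ⟩ | x
  · cases s <;> simp [axial, transverse, ite_pow]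
  · have h1 : ∑ k, transverse (.inr (.inl (h, σ))) k ^ 2 = 24 := by
      have := sum_transverse_hexad h σ fun k => (transverse (.inr (.inl (h, σ))) k : ℝ)
      simp_rw [transverse_hexad] at this
      have h2 : ∑ k, transverse (.inr (.inl (h, σ))) k * transverse (.inr (.inl (h, σ))) k =
          2 * ∑ j, evenSign σ j * (2 * evenSign σ j) := by exact_mod_cast this
      simp_rw [sq, h2, mul_left_comm _ (2 : ℤ), evenSign_mul_self]
      simp
    simp [h1, axial]
  · simp [axial, transverse, sq, golaySign_mul_self]

theorem eq_of_evenSign_mul : ∀ σ τ : Fin 16, (∀ j, evenSign σ j * (2 * ∑ i, evenSign τ i) =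
    evenSign τ j * (2 * ∑ i, evenSign σ i)) → σ = τ := by
  decide +kernel

theorem golaySign_injective : Function.Injective golaySign := by
  have h : ∀ i : Fin 10, bitSign (golayColumn (i.castLE (by norm_num))) 10 = 1 ∧
      ∀ b : Fin 10, bitSign (golayColumn (i.castLE (by norm_num))) b =
        if b = i then -1 else 1 := by decide +kernel
  have hs (x : Fin 10 → Bool) (i : Fin 10) :
      golaySign x (i.castLE (by norm_num)) = if x i then -1 else 1 := by
    rw [golaySign, (h i).1, one_mul, prod_eq_single i]
    · rw [(h i).2 i, if_pos rfl]
    · intro b _ hb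
      rw [(h i).2 b, if_neg hb, ite_self]
    · simp
  intro x y hxy
  ext i
  have := congrFun hxy (i.castLE (by norm_num))
  rw [hs, hs] at this
  cases hx : x i <;> cases hy : y i <;> simp_all

theorem transverse_hexad_ne_zero_iff (h : Fin 77) (σ : Fin 16) (k : Fin 22) :
    transverse (.inr (.inl (h, σ))) k ≠ 0 ↔ k ∈ hexadSet h := by
  constructor
  · contrapose!
    intro hk
    rw [transverse, sum_eq_zero fun j _ => if_neg ?_, mul_zero]
    rintro rfl
    exact hk (mem_image_of_mem _ (mem_univ j))
  · intro hk
    obtain ⟨j, -, rfl⟩ := mem_image.mp hk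
    have := evenSign_mul_self σ j
    rw [transverse_hexad]
    intro h0
    simp_all

/-- Distinct indices give distinct lines. -/
theorem eq_of_proportional (a b : LineIndex) (hax : axial a * height b = axial b * height a)
    (htr : ∀ k, transverse a k * height b = transverse b k * height a) : a = b := by
  have ha := height_ne_zero a
  have hb := height_ne_zero b
  have hma := height_mem a
  have hmb := height_mem b
  simp only [List.mem_cons, List.not_mem_nil, or_false] at hma hmb
  have hh : axial a = axial b → axial a ≠ 0 → transverse a = transverse b := by
    intro h1 h2
    rw [h1] at hax h2
    have h3 := mul_left_cancel₀ h2 hax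
    exact funext fun k => mul_right_cancel₀ hb ((htr k).trans (by rw [h3]))
  have h11 (i s) : height (.inl (i, s)) = 12 ∨ height (.inl (i, s)) = 4 := by
    cases s <;> simp [height, axial, transverse]
  rcases a with ⟨i, s⟩ | ⟨h, σ⟩ | x <;> rcases b with ⟨i', s'⟩ | ⟨h', σ'⟩ | x'
  · have h1 := hh rfl (by simp [axial])
    have h2 := congrFun h1 i
    by_cases hi : i = i'
    · subst hi
      cases s <;> cases s' <;> simp_all [transverse]
    · cases s <;> simp_all [transverse]
  · simp [axial, hb] at hax
  · have := h11 i s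
    simp only [axial] at hax
    omega
  · simp [axial, ha] at hax
  · have h1 : hexadSet h = hexadSet h' := by
      ext k
      rw [← transverse_hexad_ne_zero_iff h σ, ← transverse_hexad_ne_zero_iff h' σ', not_iff_not]
      have := htr k
      constructor <;> intro h0 <;> rw [h0, zero_mul] at this
      · exact (mul_eq_zero.mp this.symm).resolve_right ha
      · exact (mul_eq_zero.mp this).resolve_right hb
    obtain rfl := hexadSet_injective h1
    rw [eq_of_evenSign_mul σ σ' fun j => ?_]
    have := htr (hexad h j)
    rw [transverse_hexad, transverse_hexad, height_hexad, height_hexad] at this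
    linarith
  · simp [axial, ha.symm] at hax
  · have := h11 i' s'
    simp only [axial] at hax
    omega
  · simp [axial, hb] at hax
  · have h1 := hh rfl (by simp [axial])
    rw [golaySign_injective h1]

/-- The lines form a tight projective design. -/
theorem sum_pow_six (s : ℝ) (v : Fin 22 → ℝ) :
    ∑ a, (axial a * s + ∑ k, transverse a k * v k) ^ 6 =
      30720 * (s ^ 2 / 2 + ∑ k, v k ^ 2) ^ 3 := by
  have h1 : ∑ p : Fin 22 × Bool, ((axial (.inl p) : ℝ) * s + ∑ k, transverse (.inl p) k * v k) ^ 6 =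
      128 * (22 * s ^ 6 + 60 * s ^ 4 * ∑ k, v k ^ 2 + 240 * s ^ 2 * ∑ k, v k ^ 4 +
        64 * ∑ k, v k ^ 6) := by
    have (i : Fin 22) : ∑ t : Bool, ((axial (.inl (i, t)) : ℝ) * s +
        ∑ k, transverse (.inl (i, t)) k * v k) ^ 6 =
        128 * (s ^ 6 + 60 * s ^ 4 * v i ^ 2 + 240 * s ^ 2 * v i ^ 4 + 64 * v i ^ 6) := by
      simp [axial, transverse]
      ring
    rw [Fintype.sum_prod_type]
    simp_rw [this, ← mul_sum, sum_add_distrib, ← mul_sum]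
    simp
  have h2 : ∑ p : Fin 77 × Fin 16, ((axial (.inr (.inl p)) : ℝ) * s +
      ∑ k, transverse (.inr (.inl p)) k * v k) ^ 6 =
      ∑ h, ∑ σ, (2 * ∑ j, (evenSign σ j : ℝ) * v (hexad h j)) ^ 6 := by
    rw [Fintype.sum_prod_type]
    simp_rw [sum_transverse_hexad, axial, Int.cast_zero, zero_mul, zero_add]
  have h3 : ∑ x, ((axial (.inr (.inr x)) : ℝ) * s +
      ∑ k, transverse (.inr (.inr x)) k * v k) ^ 6 =
      ∑ x, (s + ∑ k, (golaySign x k : ℝ) * v k) ^ 6 := by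
    simp_rw [axial, Int.cast_one, one_mul, transverse]
  rw [Fintype.sum_sum_type, Fintype.sum_sum_type, h1, h2, h3, sum_hexad_evenSign_pow_six,
    sum_golaySign_pow_six]
  ring

/-- Coordinates of the orthogonal projection of `(√2 ζ, z)` to the hyperplane orthogonal to
`(2√2, 1, …, 1)`, followed by an isometry of this hyperplane with `ℝ²²`. -/
noncomputable def project (ζ : ℝ) (z : Fin 22 → ℝ) (k : Fin 22) : ℝ :=
  z k + ζ / √15 - (1 + 2 / √15) / 22 * ∑ i, z i

theorem inv_sqrt_fifteen_sq : (1 / √15) ^ 2 = 1 / 15 := by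
  rw [div_pow, Real.sq_sqrt (by norm_num), one_pow]

theorem sum_project_sq (ζ : ℝ) (z : Fin 22 → ℝ) :
    ∑ k, project ζ z k ^ 2 = 2 * ζ ^ 2 + ∑ k, z k ^ 2 - (4 * ζ + ∑ k, z k) ^ 2 / 30 := by
  have hr := inv_sqrt_fifteen_sq
  simp only [project, add_sub_assoc, add_sq, sum_add_distrib, mul_assoc, ← mul_sum, ← sum_mul,
    sum_const, card_univ, Fintype.card_fin, nsmul_eq_mul]
  push_cast
  generalize ∑ k, z k = Z
  rw [div_eq_mul_one_div ζ, div_eq_mul_one_div 2 √15]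
  generalize 1 / √15 = r at *
  linear_combination (22 * ζ ^ 2 - 4 * ζ * Z + 2 / 11 * Z ^ 2) * hr

theorem sum_mul_project (ζ t : ℝ) (z u : Fin 22 → ℝ) :
    t * (4 * ζ + ∑ k, z k) + ∑ k, u k * project ζ z k =
      ζ * (4 * t + (∑ k, u k) / √15) +
        ∑ k, z k * (u k + t - (1 + 2 / √15) / 22 * ∑ i, u i) := by
  simp only [project, mul_sub, mul_add, sum_sub_distrib, sum_add_distrib, ← sum_mul]
  rw [sum_congr rfl fun k _ => mul_comm (u k) (z k)]
  ring

theorem dual_project_sq (t : ℝ) (u : Fin 22 → ℝ) :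
    (4 * t + (∑ k, u k) / √15) ^ 2 / 2 +
        ∑ k, (u k + t - (1 + 2 / √15) / 22 * ∑ i, u i) ^ 2 =
      30 * t ^ 2 + ∑ k, u k ^ 2 := by
  have hr := inv_sqrt_fifteen_sq
  simp only [add_sub_assoc, add_sq, sum_add_distrib, mul_assoc, ← mul_sum, ← sum_mul,
    sum_const, card_univ, Fintype.card_fin, nsmul_eq_mul]
  push_cast
  generalize ∑ k, u k = U
  rw [div_eq_mul_one_div U, div_eq_mul_one_div 2 √15]
  generalize 1 / √15 = r at *
  linear_combination (1 / 2 + 2 / 11) * U ^ 2 * hr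

/-- The point of the design given by a line: its intersection with a hyperplane orthogonal to
`(2√2, 1, …, 1)`. -/
noncomputable def point (a : LineIndex) : EuclideanSpace ℝ (Fin 22) :=
  WithLp.toLp 2 fun k => √(15 / 2) / height a * project (axial a) (fun i => transverse a i) k

theorem height_cast_ne_zero (a : LineIndex) : (height a : ℝ) ≠ 0 :=
  Int.cast_ne_zero.mpr (height_ne_zero a)

theorem norm_point_sq (a : LineIndex) :
    ‖point a‖ ^ 2 = (720 - (height a : ℝ) ^ 2) / (4 * (height a : ℝ) ^ 2) := by
  have h0 := height_cast_ne_zero a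
  have h1 : (2 * (axial a : ℝ) ^ 2 + ∑ k, (transverse a k : ℝ) ^ 2) = 24 := by
    exact_mod_cast norm_transverse a
  have h2 : 4 * (axial a : ℝ) + ∑ k, (transverse a k : ℝ) = height a := by
    simp [height]
  rw [EuclideanSpace.real_norm_sq_eq]
  simp only [point, mul_pow, ← mul_sum, sum_project_sq]
  rw [h1, h2, div_pow, Real.sq_sqrt (by norm_num)]
  field_simp
  ring

theorem sum_height_mul_pow (τ : ℝ) (u : EuclideanSpace ℝ (Fin 22)) :
    ∑ a, (height a : ℝ) ^ 6 * (τ + ⟪u, point a⟫) ^ 6 =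
      30720 * (30 * τ ^ 2 + 15 / 2 * ‖u‖ ^ 2) ^ 3 := by
  have h1 (a : LineIndex) : (height a : ℝ) ^ 6 * (τ + ⟪u, point a⟫) ^ 6 =
      (axial a * (4 * τ + (∑ k, √(15 / 2) * u k) / √15) + ∑ k, transverse a k *
        (√(15 / 2) * u k + τ - (1 + 2 / √15) / 22 * ∑ i, √(15 / 2) * u i)) ^ 6 := by
    have h2 : 4 * (axial a : ℝ) + ∑ k, (transverse a k : ℝ) = height a := by
      simp [height]
    rw [← mul_pow, ← sum_mul_project, h2, PiLp.inner_apply]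
    congr 1
    rw [mul_add, mul_comm, mul_sum]
    congr 1
    refine sum_congr rfl fun k _ => ?_
    have h0 := height_cast_ne_zero a
    simp only [point, RCLike.inner_apply, conj_trivial]
    field_simp
  simp_rw [h1]
  rw [sum_pow_six, dual_project_sq, EuclideanSpace.real_norm_sq_eq]
  simp_rw [mul_pow, ← mul_sum]
  rw [Real.sq_sqrt (by norm_num)]

theorem point_injective : Function.Injective point := by
  intro a b hab
  have ha := height_cast_ne_zero a
  have hb := height_cast_ne_zero b
  set δ : ℝ := axial a / height a - axial b / height b with hδ
  set d : Fin 22 → ℝ := fun k => transverse a k / height a - transverse b k / height b with hd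
  have hsum : ∑ k, d k = (∑ k, (transverse a k : ℝ)) / height a -
      (∑ k, (transverse b k : ℝ)) / height b := by
    rw [hd, sum_sub_distrib, sum_div, sum_div]
  have hheight : 4 * δ + ∑ k, d k = 0 := by
    have h2 (a) : 4 * (axial a : ℝ) + ∑ k, (transverse a k : ℝ) = height a := by
      simp [height]
    have h3 : 4 * δ + ∑ k, d k = (height a : ℝ) / height a - (height b : ℝ) / height b := by
      rw [hsum, hδ, ← h2 a, ← h2 b]
      ring
    rw [h3, div_self ha, div_self hb, sub_self]
  have hproj (k) : project δ d k = 0 := by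
    have h4 : √(15 / 2) / height a * project (axial a) (fun i => transverse a i) k =
      √(15 / 2) / height b * project (axial b) (fun i => transverse b i) k :=
      congrArg (fun p : EuclideanSpace ℝ (Fin 22) => p k) hab
    have h5 : √(15 / 2) * project δ d k = 0 := by
      rw [← sub_eq_zero] at h4
      rw [← h4]
      simp only [project, hsum]
      simp only [hδ, hd]
      ring
    exact (mul_eq_zero.mp h5).resolve_left (by positivity)
  have hnorm := sum_project_sq δ d
  simp only [hproj, hheight] at hnorm
  have hd0 : 0 ≤ ∑ k, d k ^ 2 := sum_nonneg fun k _ => sq_nonneg _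
  have hδ0 : δ = 0 := by
    rw [← sq_eq_zero_iff]
    norm_num at hnorm
    nlinarith [sq_nonneg δ]
  have hdk : ∑ k, d k ^ 2 = 0 := by
    norm_num [hδ0] at hnorm
    exact hnorm.symm
  refine eq_of_proportional a b ?_ fun k => ?_
  · rw [hδ, sub_eq_zero, div_eq_div_iff ha hb] at hδ0
    exact_mod_cast hδ0
  · have hk := pow_eq_zero_iff (two_ne_zero) |>.mp
      ((sum_eq_zero_iff_of_nonneg fun k _ => sq_nonneg (d k)).mp hdk k (mem_univ k))
    rw [hd, sub_eq_zero, div_eq_div_iff ha hb] at hk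
    exact_mod_cast hk

theorem height_pow_six (a : LineIndex) :
    (height a : ℝ) ^ 6 = if height a = 12 then 4096 * 729 else 4096 := by
  have := height_mem a
  simp only [List.mem_cons, List.not_mem_nil, or_false] at this
  rcases this with h | h | h <;> rw [h] <;> norm_num

theorem card_filter_eq_of_sum_weights {ι : Type*} [Fintype ι] (p : ι → Prop) [DecidablePred p]
    (hcard : Fintype.card ι = 2300)
    (hsum : ∑ a, (if p a then 4096 * 729 else 4096 : ℝ) = 829440000) :
    (univ.filter p).card = 275 ∧ (univ.filter fun a => ¬ p a).card = 2025 := by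
  rw [sum_ite, sum_const, sum_const, nsmul_eq_mul, nsmul_eq_mul] at hsum
  have h2 := card_filter_add_card_filter_not (s := univ) p
  rw [card_univ, hcard] at h2
  have h3 := congrArg (Nat.cast : ℕ → ℝ) h2
  push_cast at h3
  have h4 : ((univ.filter p).card : ℝ) = 275 := by linarith
  have h5 : (univ.filter p).card = 275 := by exact_mod_cast h4
  exact ⟨h5, by omega⟩

theorem card_height :
    (univ.filter fun a => height a = 12).card = 275 ∧
      (univ.filter fun a => ¬ height a = 12).card = 2025 := by
  refine card_filter_eq_of_sum_weights _ card_lineIndex ?_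
  have h1 := sum_height_mul_pow 1 0
  rw [sum_congr rfl fun a _ => by
    rw [inner_zero_left, add_zero, one_pow, mul_one, height_pow_six]] at h1
  rw [h1, norm_zero]
  norm_num

theorem norm_point (a : LineIndex) : ‖point a‖ = if height a = 12 then 1 else √11 := by
  rw [← sq_eq_sq₀ (norm_nonneg _) (by split_ifs <;> positivity), norm_point_sq]
  have := height_mem a
  simp only [List.mem_cons, List.not_mem_nil, or_false] at this
  rcases this with h | h | h <;> rw [h] <;> norm_num

/-- A linear functional on polynomials of degree at most `t` is determined by its values on the
`t`-th powers of affine functions. -/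
theorem linearMap_eq_zero_of_affine_pow {n t : ℕ} (ℓ : MvPolynomial (Fin n) ℝ →ₗ[ℝ] ℝ)
    (hℓ : ∀ (τ : ℝ) (v : Fin n → ℝ), ℓ ((C τ + ∑ i, C (v i) * X i) ^ t) = 0)
    (f : MvPolynomial (Fin n) ℝ) (hf : f.totalDegree ≤ t) : ℓ f = 0 := by
  let Y : Option (Fin n) → MvPolynomial (Fin n) ℝ := fun o => o.elim 1 X
  have hY (k : Option (Fin n) → ℕ) (hk : k ∈ piAntidiag univ t) : ℓ (∏ o, Y o ^ k o) = 0 := by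
    let P : MvPolynomial (Option (Fin n)) ℝ := ∑ k ∈ piAntidiag univ t,
      monomial (Finsupp.equivFunOnFinite.symm k) (Nat.multinomial univ k * ℓ (∏ o, Y o ^ k o))
    have hP : P = 0 := by
      refine MvPolynomial.funext fun s => ?_
      rw [map_zero, ← hℓ (s none) fun i => s (some i)]
      have h1 : C (s none) + ∑ i, C (s (some i)) * X i = ∑ o, C (s o) * Y o := by
        simp [Fintype.sum_option, Y]
      rw [h1, sum_pow_eq_sum_piAntidiag, map_sum, map_sum]
      refine sum_congr rfl fun k _ => ?_
      have h2 : (Nat.multinomial univ k : MvPolynomial (Fin n) ℝ) * ∏ o, (C (s o) * Y o) ^ k o =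
          (Nat.multinomial univ k * ∏ o, s o ^ k o : ℝ) • ∏ o, Y o ^ k o := by
        simp_rw [mul_pow, prod_mul_distrib, smul_eq_C_mul, map_mul, map_prod, map_pow, map_natCast,
          mul_assoc]
      rw [h2, map_smul, smul_eq_mul, eval_monomial, Finsupp.prod_fintype _ _ fun _ => pow_zero _]
      simp only [Finsupp.equivFunOnFinite_symm_apply_apply]
      ring
    have h3 := congrArg (coeff (Finsupp.equivFunOnFinite.symm k)) hP
    rw [coeff_sum, sum_eq_single_of_mem k hk fun k' _ hne => by
      rw [coeff_monomial, if_neg (Finsupp.equivFunOnFinite.symm.injective.ne hne)],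
      coeff_monomial, if_pos rfl, coeff_zero] at h3
    exact (mul_eq_zero.mp h3).resolve_left (Nat.cast_ne_zero.mpr (Nat.multinomial_pos _ _).ne')
  rw [f.as_sum, map_sum]
  refine sum_eq_zero fun α hα => ?_
  have hdeg : ∑ i, α i ≤ t := by
    have := (le_totalDegree hα).trans hf
    rwa [Finsupp.sum_fintype _ _ fun _ => rfl] at this
  rw [monomial_eq, ← smul_eq_C_mul, map_smul, Finsupp.prod_fintype _ _ fun _ => pow_zero _]
  have := hY (fun o => o.elim (t - ∑ i, α i) α) (by
    simp [mem_piAntidiag, Fintype.sum_option, hdeg])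
  simp only [Y, Fintype.prod_option, Option.elim, one_pow, one_mul] at this
  rw [this, smul_zero]

/-- The map induced on the unit sphere by a linear isometry. -/
noncomputable def sphereHomeomorph {E : Type*} [NormedAddCommGroup E] [NormedSpace ℝ E]
    (L : E ≃ₗᵢ[ℝ] E) : sphere (0 : E) 1 ≃ₜ sphere (0 : E) 1 :=
  L.toHomeomorph.subtype fun x => by simp

open scoped Pointwise in
theorem measurePreserving_sphereHomeomorph {E : Type*} [NormedAddCommGroup E]
    [InnerProductSpace ℝ E] [FiniteDimensional ℝ E] [MeasurableSpace E] [BorelSpace E]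
    (L : E ≃ₗᵢ[ℝ] E) :
    MeasurePreserving (sphereHomeomorph L) (volume : Measure E).toSphere
      (volume : Measure E).toSphere := by
  refine ⟨(sphereHomeomorph L).measurable, Measure.ext fun s hs => ?_⟩
  have hpre := hs.preimage (sphereHomeomorph L).measurable
  rw [Measure.map_apply (sphereHomeomorph L).measurable hs, Measure.toSphere_apply' _ hpre,
    Measure.toSphere_apply' _ hs]
  congr 1
  rw [← L.measurePreserving.measure_preimage_emb L.toHomeomorph.measurableEmbedding
    (Set.Ioo (0 : ℝ) 1 • (Subtype.val '' s))]
  congr 1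
  ext x
  simp only [Set.mem_smul, Set.mem_image, Set.mem_preimage]
  constructor
  · rintro ⟨r, hr, _, ⟨u, hu, rfl⟩, rfl⟩
    exact ⟨r, hr, _, ⟨_, hu, rfl⟩, (map_smul L r (u : E)).symm⟩
  · rintro ⟨r, hr, _, ⟨u, hu, rfl⟩, h⟩
    refine ⟨r, hr, _, ⟨(sphereHomeomorph L).symm u, by simpa using hu, rfl⟩, L.injective ?_⟩
    rw [← h, map_smul]
    congr 1
    exact congrArg Subtype.val ((sphereHomeomorph L).apply_symm_apply u)

theorem integral_inner_eq_of_norm_eq {E : Type*} [NormedAddCommGroup E]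
    [InnerProductSpace ℝ E] [FiniteDimensional ℝ E] [MeasurableSpace E] [BorelSpace E]
    (g : ℝ → ℝ) {x y : E} (h : ‖x‖ = ‖y‖) :
    ∫ u : sphere (0 : E) 1, g ⟪(u : E), x⟫ ∂(volume : Measure E).toSphere =
      ∫ u : sphere (0 : E) 1, g ⟪(u : E), y⟫ ∂(volume : Measure E).toSphere := by
  set L := (ℝ ∙ (x - y))ᗮ.reflection
  rw [← (measurePreserving_sphereHomeomorph L).integral_comp
    (sphereHomeomorph L).measurableEmbedding fun u => g ⟪(u : E), y⟫]
  refine integral_congr_ae (.of_forall fun u => ?_)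
  change g ⟪(u : E), x⟫ = g ⟪L u, y⟫
  rw [← Submodule.reflection_sub h, L.inner_map_map]

theorem integrable_sphere {n : ℕ} {g : sphere (0 : EuclideanSpace ℝ (Fin n)) 1 → ℝ}
    (hg : Continuous g) : Integrable g (volume : Measure (EuclideanSpace ℝ (Fin n))).toSphere :=
  hg.integrable_of_hasCompactSupport (HasCompactSupport.of_compactSpace g)

theorem continuous_eval_sphere {n : ℕ} (r : ℝ) (f : MvPolynomial (Fin n) ℝ) :
    Continuous fun u : sphere (0 : EuclideanSpace ℝ (Fin n)) 1 =>
      eval (fun i => r * (u : EuclideanSpace ℝ (Fin n)) i) f :=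
  (continuous_eval f).comp (by fun_prop)

theorem sphereAvg_add (n : ℕ) (r : ℝ) (f g : MvPolynomial (Fin n) ℝ) :
    sphereAvg n r (f + g) = sphereAvg n r f + sphereAvg n r g := by
  simp only [sphereAvg, average_eq, map_add]
  rw [integral_add (integrable_sphere (continuous_eval_sphere r f))
    (integrable_sphere (continuous_eval_sphere r g)), smul_add]

theorem sphereAvg_smul (n : ℕ) (r c : ℝ) (f : MvPolynomial (Fin n) ℝ) :
    sphereAvg n r (c • f) = c * sphereAvg n r f := by
  simp only [sphereAvg, average_eq, smul_eval, integral_const_mul, smul_eq_mul]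
  ring

theorem eval_affine_pow {n : ℕ} (t : ℕ) (τ : ℝ) (v x : EuclideanSpace ℝ (Fin n)) :
    eval (x : Fin n → ℝ) ((C τ + ∑ i, C (v i) * X i) ^ t) = (τ + ⟪x, v⟫) ^ t := by
  simp [PiLp.inner_apply]

/-- A weighted set is a Euclidean `t`-design as soon as its moments of affine functions are
rotation invariant. -/
theorem sum_sphereAvg_eq_of_invariant {ι : Type*} [Fintype ι] {n t : ℕ} [NeZero n] (w : ι → ℝ)
    (x : ι → EuclideanSpace ℝ (Fin n)) (K : ℝ → ℝ → ℝ)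
    (hK : ∀ τ u, ∑ a, w a * (τ + ⟪u, x a⟫) ^ t = K τ ‖u‖)
    (f : MvPolynomial (Fin n) ℝ) (hf : f.totalDegree ≤ t) :
    ∑ a, w a * sphereAvg n ‖x a‖ f = ∑ a, w a * eval (x a : Fin n → ℝ) f := by
  let ℓ : MvPolynomial (Fin n) ℝ →ₗ[ℝ] ℝ :=
    { toFun f := ∑ a, w a * sphereAvg n ‖x a‖ f - ∑ a, w a * eval (x a : Fin n → ℝ) f
      map_add' f g := by
        simp only [sphereAvg_add, map_add, mul_add, sum_add_distrib]
        ring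
      map_smul' c f := by
        simp only [sphereAvg_smul, smul_eval, mul_left_comm _ c, ← mul_sum, RingHom.id_apply,
          smul_eq_mul, mul_sub] }
  refine sub_eq_zero.mp (linearMap_eq_zero_of_affine_pow ℓ (fun τ v' => ?_) f hf)
  obtain ⟨v, rfl⟩ : ∃ v : EuclideanSpace ℝ (Fin n), v' = v := ⟨WithLp.toLp 2 v', rfl⟩
  have havg (a : ι) : sphereAvg n ‖x a‖ ((C τ + ∑ i, C (v i) * X i) ^ t) =
      ⨍ u : sphere (0 : EuclideanSpace ℝ (Fin n)) 1,
        (τ + ⟪(u : EuclideanSpace ℝ (Fin n)), ‖v‖ • x a⟫) ^ t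
        ∂(volume : Measure (EuclideanSpace ℝ (Fin n))).toSphere := by
    simp only [sphereAvg, average_eq]
    rw [← integral_inner_eq_of_norm_eq (fun s => (τ + s) ^ t)
      (show ‖‖x a‖ • v‖ = ‖‖v‖ • x a‖ by simp [norm_smul, mul_comm])]
    congr 2
    ext u
    have := eval_affine_pow t τ v (‖x a‖ • (u : EuclideanSpace ℝ (Fin n)))
    rw [real_inner_smul_left, ← real_inner_smul_right] at this
    exact this
  change ∑ a, w a * sphereAvg n ‖x a‖ _ - ∑ a, w a * eval (x a : Fin n → ℝ) _ = 0
  rw [sub_eq_zero]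
  simp_rw [havg, eval_affine_pow, real_inner_comm v]
  rw [hK]
  simp only [average_eq, smul_eq_mul, mul_left_comm (w _), ← mul_sum]
  simp_rw [← integral_const_mul]
  rw [← integral_finsetSum _ fun a _ => integrable_sphere (by fun_prop)]
  have hconst (u : sphere (0 : EuclideanSpace ℝ (Fin n)) 1) :
      ∑ a, w a * (τ + ⟪(u : EuclideanSpace ℝ (Fin n)), ‖v‖ • x a⟫) ^ t = K τ ‖v‖ := by
    simp_rw [real_inner_smul_right, ← real_inner_smul_left]
    rw [hK, norm_smul, norm_eq_of_mem_sphere, norm_norm, mul_one]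
  simp_rw [hconst]
  rw [integral_const, smul_eq_mul, ← mul_assoc, inv_mul_cancel₀, one_mul]
  rw [Measure.real, ENNReal.toReal_ne_zero]
  exact ⟨by simpa using ⟨NeZero.ne n, (measure_ball_pos _ _ one_pos).ne'⟩, measure_ne_top _ _⟩

/-- Points on the spheres of radius `1` and `√11`, weighted by `729` and `1`, form a Euclidean
6-design if their weighted sixth moments of affine functions are rotation invariant. -/
theorem exists_design_of_invariant {ι : Type*} [Fintype ι] (p : ι → Prop) [DecidablePred p]
    (point : ι → EuclideanSpace ℝ (Fin 22)) (hpoint : Function.Injective point)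
    (hnorm : ∀ a, ‖point a‖ = if p a then 1 else √11)
    (hcard : (univ.filter p).card = 275 ∧ (univ.filter fun a => ¬ p a).card = 2025)
    (K : ℝ → ℝ → ℝ)
    (hK : ∀ τ u, ∑ a, (if p a then 729 else 1) * (τ + ⟪u, point a⟫) ^ 6 = K τ ‖u‖) :
    ∃ X₁ X₂ : Finset (EuclideanSpace ℝ (Fin 22)),
      (∀ x ∈ X₁, ‖x‖ = 1) ∧ (∀ x ∈ X₂, ‖x‖ = Real.sqrt 11) ∧
      X₁.card = 275 ∧ X₂.card = 2025 ∧ (X₁ ∪ X₂).card = Nat.choose 25 3 ∧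
      ∀ f : MvPolynomial (Fin 22) ℝ, f.totalDegree ≤ 6 →
        (∑ _x ∈ X₁, (729 : ℝ)) * sphereAvg 22 1 f
            + (∑ _x ∈ X₂, (1 : ℝ)) * sphereAvg 22 (Real.sqrt 11) f
          = ∑ x ∈ X₁, 729 * eval (x : Fin 22 → ℝ) f
            + ∑ x ∈ X₂, 1 * eval (x : Fin 22 → ℝ) f := by
  set A : Finset ι := univ.filter p
  set B : Finset ι := univ.filter fun a => ¬ p a
  have hA (a) (ha : a ∈ A) : p a := (mem_filter.mp ha).2
  have hB (a) (ha : a ∈ B) : ¬ p a := (mem_filter.mp ha).2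
  have hAB : Disjoint A B := disjoint_filter_filter_not _ _ _
  refine ⟨A.map ⟨point, hpoint⟩, B.map ⟨point, hpoint⟩, ?_, ?_, ?_, ?_, ?_, ?_⟩
  · simp only [forall_mem_map]
    intro a ha
    exact (hnorm a).trans (if_pos (hA a ha))
  · simp only [forall_mem_map]
    intro a ha
    exact (hnorm a).trans (if_neg (hB a ha))
  · rw [card_map]
    exact hcard.1
  · rw [card_map]
    exact hcard.2
  · rw [← map_union, card_map, card_union_of_disjoint hAB, hcard.1, hcard.2]
    rfl
  · intro f hf
    have h := sum_sphereAvg_eq_of_invariant (fun a => if p a then 729 else 1) point K hK f hf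
    rw [← sum_filter_add_sum_filter_not _ p, ← sum_filter_add_sum_filter_not _ p
      fun a => (if p a then 729 else 1) * eval _ f] at h
    simp only [sum_map, Function.Embedding.coeFn_mk, sum_mul]
    convert h using 2
    · exact sum_congr rfl fun a ha => by simp [hnorm, hA a ha]
    · exact sum_congr rfl fun a ha => by simp [hnorm, hB a ha]
    · exact sum_congr rfl fun a ha => by simp [hA a ha]
    · exact sum_congr rfl fun a ha => by simp [hB a ha]


/-- There exists a Euclidean tight 6-design of `ℝ²²` supported by two concentric
spheres: a set `X₁` of 275 points on the unit sphere and a set `X₂` of 2025 points on the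
sphere of radius `√11` (so `|X₁ ∪ X₂| = 2300 = C(25,3)`), such that with weight `729` on `X₁`
and `1` on `X₂` the pair is a Euclidean 6-design. -/
theorem statement0 :
    ∃ X₁ X₂ : Finset (EuclideanSpace ℝ (Fin 22)),
      (∀ x ∈ X₁, ‖x‖ = 1) ∧ (∀ x ∈ X₂, ‖x‖ = Real.sqrt 11) ∧
      X₁.card = 275 ∧ X₂.card = 2025 ∧ (X₁ ∪ X₂).card = Nat.choose 25 3 ∧
      ∀ f : MvPolynomial (Fin 22) ℝ, f.totalDegree ≤ 6 →
        (∑ _x ∈ X₁, (729 : ℝ)) * sphereAvg 22 1 f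
            + (∑ _x ∈ X₂, (1 : ℝ)) * sphereAvg 22 (Real.sqrt 11) f
          = ∑ x ∈ X₁, 729 * eval (x : Fin 22 → ℝ) f
            + ∑ x ∈ X₂, 1 * eval (x : Fin 22 → ℝ) f := by
  refine exists_design_of_invariant (fun a => height a = 12) point point_injective norm_point
    card_height (fun τ ρ => 30720 * (30 * τ ^ 2 + 15 / 2 * ρ ^ 2) ^ 3 / 4096) fun τ u => ?_
  rw [← sum_height_mul_pow, sum_div]
  refine sum_congr rfl fun a _ => ?_
  rw [height_pow_six]
  split_ifs <;> ring
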